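/- arXiv:1501.06393 — 2 statements merged into one kernel-verified Lean document; each statement's English description precedes it below -/
import Mathlib

section
/- For any real numbers (or nonzero integers) x_1,...,x_p, m, n, y_1,...,y_q with all relevant continued fractions defined, and ε = ±1, the continued fraction values satisfy [x_1,...,x_p, m, -n, -y_1,...,-y_q] = [x_1,...,x_p, m-ε, ε, n-ε, y_1,...,y_q], where [a_1,...,a_k] denotes the continued fraction a_1 + 1/(a_2 + 1/(... + 1/a_k)). -/
/-- Continued fraction `[a₁,…,a_k] = a₁ + 1/(a₂ + 1/(⋯ + 1/a_k))` over ℝ. -/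
noncomputable def cfR : List ℝ → ℝ
  | [] => 0
  | [a] => a
  | a :: b :: l => a + (cfR (b :: l))⁻¹

/-- All continued fractions appearing as denominators are nonzero (well-definedness). -/
def cfRDefined (l : List ℝ) : Prop :=
  ∀ t ∈ l.tails, t ≠ [] → t ≠ l → cfR t ≠ 0

theorem cfR_cons_eq (a : ℝ) (l : List ℝ) : cfR (a :: l) = a + (cfR l)⁻¹ := by
  cases l <;> simp [cfR]

theorem cfR_map_neg (l : List ℝ) : cfR (l.map (fun a => -a)) = - cfR l := by
  induction l with
  | nil => simp [cfR]
  | cons a l ih =>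
    rw [List.map_cons, cfR_cons_eq, cfR_cons_eq, ih, inv_neg]
    ring

theorem cfR_append_congr (x l l' : List ℝ) (h : cfR l = cfR l') :
    cfR (x ++ l) = cfR (x ++ l') := by
  induction x with
  | nil => simpa using h
  | cons a x ih => rw [List.cons_append, List.cons_append, cfR_cons_eq, cfR_cons_eq, ih]

theorem cfRDefined_ne (l p t : List ℝ) (h : cfRDefined l) (hl : l = p ++ t) (hp : p ≠ [])
    (ht : t ≠ []) : cfR t ≠ 0 := by
  subst hl
  refine h t ?_ ht ?_
  · rw [List.mem_tails]
    exact List.suffix_append p t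
  · intro he
    exact hp (List.self_eq_append_left.mp he)

/-- Lagrange isotopy identity:
`[x, m, -n, -y] = [x, m-ε, ε, n-ε, y]` for `ε = ±1`. -/
theorem lagrange_continued_fraction (x y : List ℝ) (m n ε : ℝ)
    (hε : ε = 1 ∨ ε = -1)
    (h1 : cfRDefined (x ++ m :: (-n) :: y.map (fun a => -a)))
    (h2 : cfRDefined (x ++ (m - ε) :: ε :: (n - ε) :: y)) :
    cfR (x ++ m :: (-n) :: y.map (fun a => -a)) =
      cfR (x ++ (m - ε) :: ε :: (n - ε) :: y) := by
  have a1 := cfRDefined_ne _ (x ++ [m]) ((-n) :: y.map (fun a => -a)) h1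
    (by simp) (by simp) (by simp)
  have a2 := cfRDefined_ne _ (x ++ [m - ε, ε]) ((n - ε) :: y) h2 (by simp) (by simp) (by simp)
  apply cfR_append_congr
  simp only [cfR_cons_eq, cfR_map_neg, inv_neg] at a1 a2 ⊢
  obtain ⟨w, hw⟩ : ∃ w, w = n + (cfR y)⁻¹ := ⟨_, rfl⟩
  have e1 : -n + -(cfR y)⁻¹ = -w := by rw [hw]; ring
  have e2 : n - ε + (cfR y)⁻¹ = w - ε := by rw [hw]; ring
  rw [e1] at a1 ⊢
  rw [e2] at a2 ⊢
  have hw0 : w ≠ 0 := by simpa using a1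
  have e3 : ε + (w - ε)⁻¹ = ε * w / (w - ε) := by
    field_simp
    rcases hε with rfl | rfl <;> ring
  rw [e3]
  rcases hε with rfl | rfl <;> field_simp <;> ring
end

section
/- For coprime positive integers a and b, the curve (T_a(t), T_b(t)) has exactly (a-1)(b-1)/2 real double points, all with distinct x-coordinates when a = 3. -/
open Polynomial Polynomial.Chebyshev

/-- Ordered double points. -/
def dpE (a b : ℕ) : Set (ℝ × ℝ) :=
  {p | p.1 ≠ p.2 ∧ (T ℝ a).eval p.1 = (T ℝ a).eval p.2 ∧
      (T ℝ b).eval p.1 = (T ℝ b).eval p.2}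

lemma dp_T_abs (n : ℕ) (x : ℝ) : |(T ℝ n).eval x| = abs ((T ℝ n).eval (abs x)) := by
  rcases abs_choice x with h | h
  · rw [h]
  · rw [h, T_eval_neg, abs_mul]
    rcases Int.even_or_odd (n : ℤ) with h2 | h2
    · simp [Int.negOnePow_even _ h2]
    · simp [Int.negOnePow_odd _ h2]

lemma dp_abs_eq {a : ℕ} (ha : 0 < a) {s t : ℝ} (hs : 1 < |s|) (ht : 1 < |t|)
    (h : (T ℝ a).eval s = (T ℝ a).eval t) : |s| = |t| := by
  have h1 : (T ℝ a).eval |s| = (T ℝ a).eval |t| := by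
    have e : abs ((T ℝ a).eval (abs s)) = abs ((T ℝ a).eval (abs t)) := by
      rw [← dp_T_abs, ← dp_T_abs, h]
    have p1 := one_le_eval_T_real a hs.le
    have p2 := one_le_eval_T_real a ht.le
    have q1 := abs_of_nonneg (zero_le_one.trans p1)
    have q2 := abs_of_nonneg (zero_le_one.trans p2)
    exact q1.symm.trans (e.trans q2)
  have c1 := Real.cosh_arcosh hs.le
  have c2 := Real.cosh_arcosh ht.le
  have cc : ∀ x y : ℝ, Real.cosh x = Real.cosh y ↔ |x| = |y| := by
    intro x y
    rw [le_antisymm_iff, le_antisymm_iff, Real.cosh_le_cosh, Real.cosh_le_cosh]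
  rw [← c1, ← c2, T_real_cosh, T_real_cosh, cc, abs_mul, abs_mul] at h1
  have ha' : |(((a : ℕ) : ℤ) : ℝ)| ≠ 0 := by
    simp; omega
  have h2 := mul_left_cancel₀ ha' h1
  rw [← c1, ← c2, cc, h2]

lemma dp_even {a : ℕ} {t : ℝ} (ht : 1 < |t|)
    (h : (T ℝ a).eval (-t) = (T ℝ a).eval t) : Even a := by
  by_contra hodd
  rw [Nat.not_even_iff_odd] at hodd
  rw [T_eval_neg, Int.negOnePow_odd _ (by exact_mod_cast hodd)] at h
  have := one_le_abs_eval_T_real a ht.le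
  have h0 : (T ℝ a).eval t = 0 := by
    simp at h; linarith
  rw [h0] at this
  norm_num at this

lemma dp_abs_le {a b : ℕ} (ha : 0 < a) (hab : Nat.Coprime a b)
    {p : ℝ × ℝ} (hp : p ∈ dpE a b) : |p.1| ≤ 1 ∧ |p.2| ≤ 1 := by
  obtain ⟨hne, h1, h2⟩ := hp
  have ha' : (a : ℤ) ≠ 0 := by omega
  have hiff : |p.1| ≤ 1 ↔ |p.2| ≤ 1 := by
    have i1 := abs_eval_T_real_le_one_iff ha' p.1
    have i2 := abs_eval_T_real_le_one_iff ha' p.2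
    rw [h1] at i1
    exact i1.trans i2.symm
  by_contra hcon
  have ht : 1 < |p.2| := by
    by_contra hh
    exact hcon ⟨hiff.2 (not_lt.1 hh), not_lt.1 hh⟩
  have hs : 1 < |p.1| := by
    by_contra hh
    exact absurd (hiff.1 (not_lt.1 hh)) (not_le.2 ht)
  have e := dp_abs_eq ha hs ht h1
  rcases abs_eq_abs.1 e with e | e
  · exact hne e
  · rw [e] at h1 h2
    have e1 := (dp_even ht h1).two_dvd
    have e2 := (dp_even ht h2).two_dvd
    have := Nat.dvd_gcd e1 e2
    rw [hab] at this
    omega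

/-- The angle with numerators `k`, `l`. -/
noncomputable def dpA (a b : ℕ) (k l : ℤ) : ℝ := Real.pi * (k / a + l / b)

lemma dp_cancel {n : ℕ} (hn : 0 < n) {x : ℝ} {k : ℤ} (h : n * x = 2 * k * Real.pi) :
    x = 2 * Real.pi * (k / n) := by
  have : (n : ℝ) ≠ 0 := by positivity
  field_simp
  linarith

lemma dp_both {a b : ℕ} (ha : 0 < a) (hb : 0 < b) (hab : Nat.Coprime a b)
    {x : ℝ} {k l : ℤ} (h1 : a * x = 2 * k * Real.pi) (h2 : b * x = 2 * l * Real.pi) :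
    ∃ c : ℤ, x = 2 * c * Real.pi := by
  have e : (b : ℤ) * k = a * l := by
    have : (b : ℝ) * k = a * l := by
      have hp := Real.pi_pos.ne'
      apply mul_left_cancel₀ (mul_ne_zero two_ne_zero hp)
      linear_combination (-(b:ℝ)) * h1 + a * h2
    exact_mod_cast this
  have hd : (a : ℤ) ∣ k :=
    (Nat.isCoprime_iff_coprime.2 hab).dvd_of_dvd_mul_left ⟨l, e⟩
  obtain ⟨c, rfl⟩ := hd
  refine ⟨c, ?_⟩
  have : (a : ℝ) ≠ 0 := by positivity
  apply mul_left_cancel₀ this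
  rw [h1]; push_cast; ring

lemma dp_cos_eq {x y : ℝ} : Real.cos x = Real.cos y ↔
    (∃ k : ℤ, x - y = 2 * k * Real.pi) ∨ (∃ k : ℤ, x + y = 2 * k * Real.pi) := by
  rw [eq_comm, Real.cos_eq_cos_iff, exists_or]
  constructor
  · rintro (⟨k, h⟩ | ⟨k, h⟩)
    · exact Or.inl ⟨k, by linarith⟩
    · exact Or.inr ⟨k, by linarith⟩
  · rintro (⟨k, h⟩ | ⟨k, h⟩)
    · exact Or.inl ⟨k, by linarith⟩
    · exact Or.inr ⟨k, by linarith⟩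

lemma dp_param {a b : ℕ} (ha : 0 < a) (hb : 0 < b) (hab : Nat.Coprime a b)
    {p : ℝ × ℝ} (hp : p ∈ dpE a b) : ∃ k l : ℤ, ¬ (a : ℤ) ∣ k ∧ ¬ (b : ℤ) ∣ l ∧
      p.1 = Real.cos (dpA a b k l) ∧ p.2 = Real.cos (dpA a b (-k) l) := by
  obtain ⟨hs, ht⟩ := dp_abs_le ha hab hp
  rw [abs_le] at hs ht
  obtain ⟨hne, h1, h2⟩ := hp
  have c1 := Real.cos_arccos hs.1 hs.2
  have c2 := Real.cos_arccos ht.1 ht.2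
  have key : ∀ x y : ℝ, Real.cos x = p.1 → Real.cos y = p.2 →
      ∀ k l : ℤ, a * x - a * y = 2 * k * Real.pi → b * x + b * y = 2 * l * Real.pi →
      ∃ k l : ℤ, ¬ (a : ℤ) ∣ k ∧ ¬ (b : ℤ) ∣ l ∧
      p.1 = Real.cos (dpA a b k l) ∧ p.2 = Real.cos (dpA a b (-k) l) := by
    intro x y hx hy k l hk hl
    have e1 := dp_cancel ha (x := x - y) (by linarith : _ = 2 * (k:ℝ) * Real.pi)
    have e2 := dp_cancel hb (x := x + y) (by linarith : _ = 2 * (l:ℝ) * Real.pi)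
    have haR : (a : ℝ) ≠ 0 := by positivity
    have hbR : (b : ℝ) ≠ 0 := by positivity
    refine ⟨k, l, ?_, ?_, ?_, ?_⟩
    · rintro ⟨c, rfl⟩
      apply hne
      rw [← hx, ← hy, dp_cos_eq]
      refine Or.inl ⟨c, ?_⟩
      rw [e1]; push_cast; field_simp
    · rintro ⟨c, rfl⟩
      apply hne
      rw [← hx, ← hy, dp_cos_eq]
      refine Or.inr ⟨c, ?_⟩
      rw [e2]; push_cast; field_simp
    · rw [← hx]; congr 1; unfold dpA; linarith
    · rw [← hy]; congr 1; unfold dpA; push_cast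
      rw [neg_div]; linarith
  set x := Real.arccos p.1
  set y := Real.arccos p.2
  rw [← c1, ← c2, T_real_cos, T_real_cos, dp_cos_eq] at h1 h2
  push_cast at h1 h2
  rcases h1 with ⟨k, h1⟩ | ⟨k, h1⟩ <;> rcases h2 with ⟨l, h2⟩ | ⟨l, h2⟩
  · exfalso
    obtain ⟨c, hc⟩ := dp_both ha hb hab (x := x - y) (by linarith : _ = 2 * (k:ℝ) * Real.pi)
      (by linarith : _ = 2 * (l:ℝ) * Real.pi)
    apply hne
    rw [← c1, ← c2, dp_cos_eq]
    exact Or.inl ⟨c, hc⟩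
  · exact key x y c1 c2 k l h1 h2
  · exact key x (-y) c1 (by rw [Real.cos_neg, c2]) k l (by linarith) (by linarith)
  · exfalso
    obtain ⟨c, hc⟩ := dp_both ha hb hab (x := x + y) (by linarith : _ = 2 * (k:ℝ) * Real.pi)
      (by linarith : _ = 2 * (l:ℝ) * Real.pi)
    apply hne
    rw [← c1, ← c2, dp_cos_eq]
    exact Or.inr ⟨c, hc⟩

lemma dp_int {n : ℕ} (hn : 0 < n) {k c : ℤ}
    (h : 2 * Real.pi * ((k : ℝ) / n) = 2 * c * Real.pi) : (n : ℤ) ∣ k := by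
  refine ⟨c, ?_⟩
  have hnR : (n : ℝ) ≠ 0 := by positivity
  have hp := Real.pi_pos.ne'
  have : (k : ℝ) = n * c := by
    field_simp at h
    linarith
  exact_mod_cast this

lemma dp_mem {a b : ℕ} (ha : 0 < a) (hb : 0 < b) {k l : ℤ}
    (hk : ¬ (a : ℤ) ∣ k) (hl : ¬ (b : ℤ) ∣ l) :
    (Real.cos (dpA a b k l), Real.cos (dpA a b (-k) l)) ∈ dpE a b := by
  have haR : (a : ℝ) ≠ 0 := by positivity
  have hbR : (b : ℝ) ≠ 0 := by positivity
  refine ⟨?_, ?_, ?_⟩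
  · simp only
    rw [Ne, dp_cos_eq]
    rintro (⟨c, h⟩ | ⟨c, h⟩)
    · apply hk
      apply dp_int ha (c := c)
      rw [← h]; unfold dpA; push_cast; ring
    · apply hl
      apply dp_int hb (c := c)
      rw [← h]; unfold dpA; push_cast; ring
  · simp only
    rw [T_real_cos, T_real_cos, dp_cos_eq]
    refine Or.inl ⟨k, ?_⟩
    unfold dpA; push_cast; field_simp; ring
  · simp only
    rw [T_real_cos, T_real_cos, dp_cos_eq]
    refine Or.inr ⟨l, ?_⟩
    unfold dpA; push_cast; field_simp; ring

lemma dpA_eq {a b : ℕ} (ha : 0 < a) (hb : 0 < b) (k l : ℤ) :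
    dpA a b k l = Real.pi * ((k * b + l * a : ℤ) / (a * b : ℝ)) := by
  have haR : (a : ℝ) ≠ 0 := by positivity
  have hbR : (b : ℝ) ≠ 0 := by positivity
  unfold dpA; push_cast; field_simp

lemma dp_cosm {N : ℝ} (hN : 0 < N) {m n : ℤ}
    (h : Real.cos (Real.pi * (m / N)) = Real.cos (Real.pi * (n / N))) :
    ∃ j : ℤ, (m : ℝ) - n = 2 * j * N ∨ (m : ℝ) + n = 2 * j * N := by
  have hp := Real.pi_pos.ne'
  rcases dp_cos_eq.1 h with ⟨j, h⟩ | ⟨j, h⟩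
  · refine ⟨j, Or.inl ?_⟩
    field_simp at h
    linarith
  · refine ⟨j, Or.inr ?_⟩
    field_simp at h
    linarith

lemma dp_partner {a b : ℕ} (ha : 0 < a) (hb : 0 < b) (hab : Nat.Coprime a b)
    {k l k' l' j : ℤ} (h : k * b + l * a - (k' * b + l' * a) = 2 * j * (a * b)) :
    Real.cos (dpA a b (-k) l) = Real.cos (dpA a b (-k') l') := by
  have hcop := Nat.isCoprime_iff_coprime.2 hab
  have haR : (a : ℝ) ≠ 0 := by positivity
  have hbR : (b : ℝ) ≠ 0 := by positivity
  have h1 : (a : ℤ) ∣ (k - k') :=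
    hcop.dvd_of_dvd_mul_right ⟨2 * j * b - l + l', by linear_combination h⟩
  obtain ⟨c, hc⟩ := h1
  have h2 : l - l' = b * (2 * j - c) := by
    have ha' : (a : ℤ) ≠ 0 := by omega
    apply mul_left_cancel₀ ha'
    linear_combination h - b * hc
  rw [dp_cos_eq]
  refine Or.inl ⟨j - c, ?_⟩
  obtain rfl : k = k' + a * c := by linarith
  obtain rfl : l = l' + b * (2 * j - c) := by linarith
  unfold dpA; push_cast; field_simp; ring

lemma dp_inj {a b : ℕ} (ha : 0 < a) (hb : 0 < b) (hab : Nat.Coprime a b) :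
    Set.InjOn Prod.fst (dpE a b) := by
  intro p hp q hq hpq
  obtain ⟨k, l, -, -, p1, p2⟩ := dp_param ha hb hab hp
  obtain ⟨k', l', -, -, q1, q2⟩ := dp_param ha hb hab hq
  refine Prod.ext hpq ?_
  rw [p1, q1, dpA_eq ha hb, dpA_eq ha hb] at hpq
  rw [p2, q2]
  obtain ⟨j, h | h⟩ := dp_cosm (by positivity) hpq
  · exact dp_partner ha hb hab (j := j) (by exact_mod_cast h)
  · have : Real.cos (dpA a b (-k') l') = Real.cos (dpA a b (- -k') (-l')) := by
      rw [← Real.cos_neg]; congr 1; unfold dpA; push_cast; ring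
    rw [this]
    refine dp_partner ha hb hab (j := j) ?_
    have h' : (k * b + l * a : ℤ) + (k' * b + l' * a : ℤ) = 2 * j * (a * b) := by
      exact_mod_cast h
    linear_combination h'

/-- Numerators of the parameters of double points. -/
def dpF (a b : ℕ) : Finset ℕ :=
  (Finset.range (a * b)).filter fun m => ¬ a ∣ m ∧ ¬ b ∣ m

lemma dpF_card {a b : ℕ} (ha : 0 < a) (hb : 0 < b) (hab : Nat.Coprime a b) :
    (dpF a b).card = (a - 1) * (b - 1) := by
  have : (dpF a b).card = ((Finset.Ico 1 a) ×ˢ (Finset.Ico 1 b)).card := by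
    apply Finset.card_bij (fun m _ => (m % a, m % b))
    · intro m hm
      simp only [dpF, Finset.mem_filter, Nat.dvd_iff_mod_eq_zero] at hm
      simp only [Finset.mem_product, Finset.mem_Ico]
      have := Nat.mod_lt m ha
      have := Nat.mod_lt m hb
      omega
    · intro m hm n hn h
      simp only [dpF, Finset.mem_filter, Finset.mem_range] at hm hn
      simp only [Prod.mk.injEq] at h
      have := (Nat.modEq_and_modEq_iff_modEq_mul hab).1 h
      exact Nat.ModEq.eq_of_lt_of_lt this hm.1 hn.1
    · rintro ⟨i, j⟩ hij
      simp only [Finset.mem_product, Finset.mem_Ico] at hij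
      obtain ⟨x, hx1, hx2⟩ := Nat.chineseRemainder hab i j
      have hd1 : x % (a * b) % a = i := by
        rw [Nat.mod_mul_right_mod, hx1, Nat.mod_eq_of_lt hij.1.2]
      have hd2 : x % (a * b) % b = j := by
        rw [Nat.mod_mul_left_mod, hx2, Nat.mod_eq_of_lt hij.2.2]
      refine ⟨x % (a * b), ?_, ?_⟩
      · simp only [dpF, Finset.mem_filter, Finset.mem_range, Nat.dvd_iff_mod_eq_zero, hd1, hd2]
        refine ⟨Nat.mod_lt _ (by positivity), ?_, ?_⟩ <;> omega
      · rw [hd1, hd2]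
  rw [this]; simp

lemma dp_image {a b : ℕ} (ha : 0 < a) (hb : 0 < b) (hab : Nat.Coprime a b) :
    Prod.fst '' dpE a b =
      (fun m : ℕ => Real.cos (Real.pi * ((m : ℤ) / (a * b : ℝ)))) '' (dpF a b : Set ℕ) := by
  have hcop := Nat.isCoprime_iff_coprime.2 hab
  have haR : (a : ℝ) ≠ 0 := by positivity
  have hbR : (b : ℝ) ≠ 0 := by positivity
  have hN : (0 : ℝ) < a * b := by positivity
  have hp := Real.pi_pos
  ext s
  constructor
  · rintro ⟨p, hpE, rfl⟩
    obtain ⟨hs, -⟩ := dp_abs_le ha hab hpE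
    rw [abs_le] at hs
    obtain ⟨k, l, hk, hl, p1, -⟩ := dp_param ha hb hab hpE
    have c1 := Real.cos_arccos hs.1 hs.2
    have g0 := Real.arccos_nonneg p.1
    have g1 := Real.arccos_le_pi p.1
    set x := Real.arccos p.1
    have key : ∀ k l : ℤ, ¬ (a : ℤ) ∣ k → ¬ (b : ℤ) ∣ l → ∀ j : ℤ,
        x = dpA a b k l + 2 * j * Real.pi → p.1 ∈
        (fun m : ℕ => Real.cos (Real.pi * ((m : ℤ) / (a * b : ℝ)))) '' (dpF a b : Set ℕ) := by
      intro k l hk hl j hx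
      have hx' : x = Real.pi * ((k * b + l * a + 2 * j * (a * b) : ℤ) / (a * b : ℝ)) := by
        rw [hx]; unfold dpA; push_cast; field_simp
      have hM : ∃ M : ℤ, M = k * b + l * a + 2 * j * (a * b) := ⟨_, rfl⟩
      obtain ⟨M, hM⟩ := hM
      rw [← hM] at hx'
      have hda : ¬ (a : ℤ) ∣ M := by
        rintro ⟨c, hc⟩
        apply hk
        exact hcop.dvd_of_dvd_mul_right ⟨c - l - 2 * j * b, by linear_combination hc - hM⟩
      have hdb : ¬ (b : ℤ) ∣ M := by
        rintro ⟨c, hc⟩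
        apply hl
        exact hcop.symm.dvd_of_dvd_mul_right ⟨c - k - 2 * j * a, by linear_combination hc - hM⟩
      have hM0 : 0 ≤ M := by
        have : (0 : ℝ) ≤ M := by
          by_contra hneg
          have : Real.pi * ((M : ℝ) / (a * b)) < 0 :=
            mul_neg_of_pos_of_neg hp (div_neg_of_neg_of_pos (not_le.1 hneg) hN)
          linarith
        exact_mod_cast this
      have hM1 : M ≤ a * b := by
        have : (M : ℝ) ≤ a * b := by
          have h1 : Real.pi * ((M : ℝ) / (a * b)) ≤ Real.pi * 1 := by linarith
          have h2 := le_of_mul_le_mul_left h1 hp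
          rwa [div_le_one hN] at h2
        exact_mod_cast this
      have hM2 : M ≠ a * b := by
        rintro rfl
        exact hda ⟨_, rfl⟩
      lift M to ℕ using hM0
      refine ⟨M, ?_, ?_⟩
      · simp only [dpF, Finset.coe_filter, Finset.mem_range, Set.mem_setOf_eq]
        refine ⟨?_, ?_, ?_⟩
        · have : (M : ℤ) < a * b := lt_of_le_of_ne hM1 hM2
          exact_mod_cast this
        · exact_mod_cast hda
        · exact_mod_cast hdb
      · simp only
        rw [← hx', c1]
    rw [← c1] at p1
    rcases dp_cos_eq.1 p1 with ⟨j, hj⟩ | ⟨j, hj⟩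
    · exact key k l hk hl j (by linarith)
    · refine key (-k) (-l) (by rwa [dvd_neg]) (by rwa [dvd_neg]) j ?_
      have : dpA a b (-k) (-l) = - dpA a b k l := by
        unfold dpA; push_cast; ring
      rw [this]; linarith
  · rintro ⟨m, hm, rfl⟩
    simp only [dpF, Finset.coe_filter, Finset.mem_range, Set.mem_setOf_eq] at hm
    obtain ⟨-, hma, hmb⟩ := hm
    obtain ⟨u, v, huv⟩ := hcop
    have hm' : (m : ℤ) = (m * v) * b + (m * u) * a := by linear_combination (-(m:ℤ)) * huv
    refine ⟨_, dp_mem ha hb (k := m * v) (l := m * u) ?_ ?_, ?_⟩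
    · intro h
      apply hma
      have : (a : ℤ) ∣ m := by
        rw [hm']; exact dvd_add (h.mul_right _) (dvd_mul_left _ _)
      exact_mod_cast this
    · intro h
      apply hmb
      have : (b : ℤ) ∣ m := by
        rw [hm']; exact dvd_add (dvd_mul_left _ _) (h.mul_right _)
      exact_mod_cast this
    · simp only
      rw [dpA_eq ha hb, ← hm']

lemma dp_injF {a b : ℕ} (ha : 0 < a) (hb : 0 < b) :
    Set.InjOn (fun m : ℕ => Real.cos (Real.pi * ((m : ℤ) / (a * b : ℝ)))) (dpF a b : Set ℕ) := by
  have hN : (0 : ℝ) < a * b := by positivity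
  have hp := Real.pi_pos
  have range : ∀ m ∈ (dpF a b : Set ℕ),
      Real.pi * ((m : ℤ) / (a * b : ℝ)) ∈ Set.Icc 0 Real.pi := by
    intro m hm
    simp only [dpF, Finset.coe_filter, Finset.mem_range, Set.mem_setOf_eq] at hm
    have h1 : (m : ℝ) ≤ a * b := by exact_mod_cast hm.1.le
    push_cast
    refine ⟨by positivity, ?_⟩
    have := (div_le_one hN).2 h1
    nlinarith
  intro m hm n hn h
  have := Real.injOn_cos (range m hm) (range n hn) h
  have := mul_left_cancel₀ hp.ne' this
  rw [div_left_inj' hN.ne'] at this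
  exact_mod_cast this

lemma dpE_finite {a b : ℕ} (ha : 0 < a) (hb : 0 < b) (hab : Nat.Coprime a b) :
    (dpE a b).Finite := by
  apply Set.Finite.of_finite_image _ (dp_inj ha hb hab)
  rw [dp_image ha hb hab]
  exact (Finset.finite_toSet _).image _

lemma dpE_ncard {a b : ℕ} (ha : 0 < a) (hb : 0 < b) (hab : Nat.Coprime a b) :
    (dpE a b).ncard = (a - 1) * (b - 1) := by
  rw [← Set.ncard_image_of_injOn (dp_inj ha hb hab), dp_image ha hb hab,
    Set.ncard_image_of_injOn (dp_injF ha hb), Set.ncard_coe_finset, dpF_card ha hb hab]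

lemma dp_swap {a b : ℕ} {p : ℝ × ℝ} (h : p ∈ dpE a b) : p.swap ∈ dpE a b :=
  ⟨h.1.symm, h.2.1.symm, h.2.2.symm⟩

lemma dp_cubic {s t u v X : ℝ} (hst : s ≠ t) (hsu : s ≠ u) (hsv : s ≠ v) (htu : t ≠ u)
    (htv : t ≠ v) (huv : u ≠ v) (h1 : 4 * s ^ 3 - 3 * s = X) (h2 : 4 * t ^ 3 - 3 * t = X)
    (h3 : 4 * u ^ 3 - 3 * u = X) (h4 : 4 * v ^ 3 - 3 * v = X) : False := by
  have quad : ∀ y, s ≠ y → 4 * y ^ 3 - 3 * y = X → 4 * (s ^ 2 + s * y + y ^ 2) = 3 := by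
    intro y hy h
    apply mul_left_cancel₀ (sub_ne_zero.2 hy)
    linear_combination h1 - h
  have q1 := quad t hst h2
  have q2 := quad u hsu h3
  have q3 := quad v hsv h4
  have e1 : s + t + u = 0 := by
    apply mul_left_cancel₀ (sub_ne_zero.2 htu)
    linear_combination (q1 - q2) / 4
  have e2 : s + t + v = 0 := by
    apply mul_left_cancel₀ (sub_ne_zero.2 htv)
    linear_combination (q1 - q3) / 4
  exact huv (by linarith)

lemma dp_T3 (x : ℝ) : (T ℝ ((3 : ℕ) : ℤ)).eval x = 4 * x ^ 3 - 3 * x := by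
  have h3 : T ℝ 3 = 2 * X * T ℝ 2 - T ℝ 1 := by
    simpa using T_add_two ℝ 1
  push_cast
  rw [h3, T_two, T_one]
  simp
  ring

/-- For coprime positive integers `a, b`, the Chebyshev curve `(T_a, T_b)`
has exactly `(a-1)(b-1)/2` real double points; when `a = 3` they all have
distinct `x`-coordinates. -/
theorem double_points_chebyshev (a b : ℕ) (ha : 0 < a) (hb : 0 < b)
    (hab : Nat.Coprime a b) :
    {p : ℝ × ℝ | p.1 < p.2 ∧ (T ℝ a).eval p.1 = (T ℝ a).eval p.2 ∧
      (T ℝ b).eval p.1 = (T ℝ b).eval p.2}.Finite ∧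
    {p : ℝ × ℝ | p.1 < p.2 ∧ (T ℝ a).eval p.1 = (T ℝ a).eval p.2 ∧
      (T ℝ b).eval p.1 = (T ℝ b).eval p.2}.ncard = (a - 1) * (b - 1) / 2 ∧
    (a = 3 → ∀ p ∈ {p : ℝ × ℝ | p.1 < p.2 ∧ (T ℝ a).eval p.1 = (T ℝ a).eval p.2 ∧
        (T ℝ b).eval p.1 = (T ℝ b).eval p.2},
      ∀ q ∈ {p : ℝ × ℝ | p.1 < p.2 ∧ (T ℝ a).eval p.1 = (T ℝ a).eval p.2 ∧
        (T ℝ b).eval p.1 = (T ℝ b).eval p.2},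
      p ≠ q → (T ℝ a).eval p.1 ≠ (T ℝ a).eval q.1) := by
  have hD : ∃ D : Set (ℝ × ℝ), D = {p : ℝ × ℝ | p.1 < p.2 ∧
      (T ℝ a).eval p.1 = (T ℝ a).eval p.2 ∧
      (T ℝ b).eval p.1 = (T ℝ b).eval p.2} := ⟨_, rfl⟩
  obtain ⟨D, hD⟩ := hD
  have hsub : D ⊆ dpE a b := by
    rw [hD]
    rintro p ⟨h, h'⟩
    exact ⟨h.ne, h'⟩
  have hfin : D.Finite := (dpE_finite ha hb hab).subset hsub
  have hlt : ∀ p ∈ D, p.1 < p.2 := by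
    rw [hD]; exact fun p h => h.1
  rw [← hD]
  refine ⟨hfin, ?_, ?_⟩
  · have hE : dpE a b = D ∪ Prod.swap '' D := by
      apply Set.Subset.antisymm
      · intro p hp
        rcases lt_or_gt_of_ne hp.1 with h | h
        · left; rw [hD]; exact ⟨h, hp.2⟩
        · right
          refine ⟨p.swap, ?_, Prod.swap_swap p⟩
          rw [hD]; exact ⟨h, (dp_swap hp).2⟩
      · rintro p (hp | ⟨q, hq, rfl⟩)
        · exact hsub hp
        · exact dp_swap (hsub hq)
    have hdis : Disjoint D (Prod.swap '' D) := by
      rw [Set.disjoint_left]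
      rintro p hp ⟨q, hq, rfl⟩
      exact absurd (hlt _ hp) (not_lt.2 (hlt q hq).le)
    have hc := dpE_ncard ha hb hab
    rw [hE, Set.ncard_union_eq hdis hfin (hfin.image _),
      Set.ncard_image_of_injective _ Prod.swap_injective] at hc
    omega
  · rintro rfl p hp q hq hpq hX
    have inj := dp_inj ha hb hab
    have lp := hlt p hp
    have lq := hlt q hq
    have Ep := hsub hp
    have Eq := hsub hq
    have Tp := Ep.2.1
    have Tq := Eq.2.1
    rw [dp_T3, dp_T3] at Tp Tq hX
    refine dp_cubic (s := p.1) (t := p.2) (u := q.1) (v := q.2) lp.ne ?_ ?_ ?_ ?_ lq.ne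
      rfl Tp.symm hX.symm (Tq.symm.trans hX.symm)
    · intro h
      exact hpq (inj Ep Eq h)
    · intro h
      have := congrArg Prod.snd (inj Ep (dp_swap Eq) h)
      simp at this
      linarith
    · intro h
      have := congrArg Prod.snd (inj (dp_swap Ep) Eq h)
      simp at this
      linarith
    · intro h
      have := inj (dp_swap Ep) (dp_swap Eq) h
      exact hpq (Prod.swap_injective this)
end
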